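/- Let Σ = Σ_1 ∪ ⋯ ∪ Σ_k be a partition of the alphabet into pairwise disjoint nonempty blocks and let L ⊆ Σ* be a regular language closed under the associated partial commutation. Then the number of equivalence classes of ≡_L equals the product over i = 1,…,k of the number of distinct classes among { [u]_{≡_L} : u ∈ Σ_i* } if and only if for all u, v ∈ Σ*: u ≡_L v holds if and only if π_{Σ_i}(u) ≡_L π_{Σ_i}(v) for all i ∈ {1,…,k}. (In particular, the implication from the right-hand condition (∀i: π_{Σ_i}(u) ≡_L π_{Σ_i}(v)) to u ≡_L v holds for every language closed under the partial commutation.) -/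

import Mathlib

/-- The Nerode right-congruence of a language `L`: `u ≡_L v` iff
for all words `x`, `u ++ x ∈ L ↔ v ++ x ∈ L`. -/
def NerodeEq {α : Type*} (L : Set (List α)) (u v : List α) : Prop :=
  ∀ x : List α, u ++ x ∈ L ↔ v ++ x ∈ L

/-- The Nerode right-congruence as a setoid on words. -/
def nerodeSetoid {α : Type*} (L : Set (List α)) : Setoid (List α) where
  r := NerodeEq L
  iseqv := ⟨fun _ _ => Iff.rfl, fun h x => (h x).symm, fun h1 h2 x => (h1 x).trans (h2 x)⟩

/-- A language is regular iff its Nerode right-congruence has finitely many classes. -/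
def RegularLang {α : Type*} (L : Set (List α)) : Prop :=
  Finite (Quotient (nerodeSetoid L))

/-- The state complexity of `L`: the number of Nerode right-congruence classes. -/
noncomputable def sc {α : Type*} (L : Set (List α)) : ℕ :=
  Nat.card (Quotient (nerodeSetoid L))

/-- A language is commutative if membership only depends on the number of
occurrences of each letter. -/
def CommutativeLang {α : Type*} [DecidableEq α] (L : Set (List α)) : Prop :=
  ∀ u v : List α, (∀ x : α, u.count x = v.count x) → (u ∈ L ↔ v ∈ L)

/-- A (commutative) language has a product-form minimal automaton iff for all words
`u, v`: `u ≡_L v` holds if and only if `x^{|u|_x} ≡_L x^{|v|_x}` for every letter `x`. -/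
def HasProductForm {α : Type*} [DecidableEq α] (L : Set (List α)) : Prop :=
  ∀ u v : List α,
    NerodeEq L u v ↔
      ∀ x : α, NerodeEq L (List.replicate (u.count x) x) (List.replicate (v.count x) x)

/-- With a partition of the alphabet encoded by a coloring `c : α → Fin k`
(block `Σ_i = c⁻¹(i)`), `projC c i w` is the projection `π_{Σ_i}(w)`. -/
def projC {α : Type*} {k : ℕ} (c : α → Fin k) (i : Fin k) (w : List α) : List α :=
  w.filter (fun x => c x = i)

/-- `L` is closed under the partial commutation associated with the partition
encoded by `c : α → Fin k`: letters in distinct blocks commute. -/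
def PartialCommClosed {α : Type*} {k : ℕ} (c : α → Fin k) (L : Set (List α)) : Prop :=
  ∀ x y : α, c x ≠ c y → ∀ u v : List α,
    (u ++ x :: y :: v ∈ L ↔ u ++ y :: x :: v ∈ L)

/-- The two-sided congruence of a language. -/
def ContextEq {α : Type*} (L : Set (List α)) (u v : List α) : Prop :=
  ∀ p s : List α, p ++ (u ++ s) ∈ L ↔ p ++ (v ++ s) ∈ L

namespace ContextEq

variable {α : Type*} {L : Set (List α)} {u v w : List α}

theorem refl (L : Set (List α)) (u : List α) : ContextEq L u u := fun _ _ => Iff.rfl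

theorem symm (h : ContextEq L u v) : ContextEq L v u := fun p s => (h p s).symm

theorem trans (h : ContextEq L u v) (h' : ContextEq L v w) : ContextEq L u w :=
  fun p s => (h p s).trans (h' p s)

theorem append_left (h : ContextEq L u v) (w : List α) :
    ContextEq L (w ++ u) (w ++ v) := fun p s => by
  simpa using h (p ++ w) s

theorem append_right (h : ContextEq L u v) (w : List α) :
    ContextEq L (u ++ w) (v ++ w) := fun p s => by
  simpa using h p (w ++ s)

theorem nerodeEq (h : ContextEq L u v) : NerodeEq L u v := fun x => h [] x

end ContextEq

namespace NerodeEq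

variable {α : Type*} {L : Set (List α)} {u v w : List α}

theorem symm (h : NerodeEq L u v) : NerodeEq L v u := fun x => (h x).symm

theorem trans (h : NerodeEq L u v) (h' : NerodeEq L v w) : NerodeEq L u w :=
  fun x => (h x).trans (h' x)

theorem append_right (h : NerodeEq L u v) (w : List α) :
    NerodeEq L (u ++ w) (v ++ w) := fun x => by
  simpa using h (w ++ x)

end NerodeEq

namespace PartialCommClosed

variable {α : Type*} {k : ℕ} {c : α → Fin k} {L : Set (List α)}

theorem contextEq_cons (hcl : PartialCommClosed c L) (x : α) (w : List α)
    (hw : ∀ y ∈ w, c x ≠ c y) : ContextEq L (x :: w) (w ++ [x]) := by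
  induction w with
  | nil => exact .refl L _
  | cons y w ih =>
    have hswap : ContextEq L (x :: y :: w) (y :: x :: w) := fun p s =>
      hcl x y (hw y (by simp)) p (w ++ s)
    exact hswap.trans ((ih fun z hz => hw z (by simp [hz])).append_left [y])

theorem contextEq_append_comm (hcl : PartialCommClosed c L) (u w : List α)
    (h : ∀ x ∈ u, ∀ y ∈ w, c x ≠ c y) : ContextEq L (u ++ w) (w ++ u) := by
  induction u with
  | nil => simpa using ContextEq.refl L w
  | cons x u ih =>
    have h₁ := (ih fun z hz => h z (by simp [hz])).append_left [x]
    have h₂ := (hcl.contextEq_cons x w (h x (by simp))).append_right u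
    exact h₁.trans (by simpa using h₂)

theorem contextEq_filter_insert (hcl : PartialCommClosed c L) {i : Fin k}
    {S : Finset (Fin k)} (hi : i ∉ S) (u : List α) :
    ContextEq L (u.filter (fun x => c x ∈ insert i S))
      (u.filter (fun x => c x ∈ S) ++ projC c i u) := by
  induction u with
  | nil => exact .refl L _
  | cons x u ih =>
    by_cases hx : c x = i
    · have hxS : c x ∉ S := hx ▸ hi
      have hmove := (hcl.contextEq_cons x (u.filter (fun x => c x ∈ S)) (by
        intro y hy hxy
        rw [List.mem_filter] at hy
        exact hxS (hxy ▸ by simpa using hy.2))).append_right (projC c i u)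
      have h := (ih.append_left [x]).trans hmove
      simpa [projC, List.filter_cons, hx, hi] using h
    · by_cases hxS : c x ∈ S
      · simpa [projC, List.filter_cons, hx, hxS] using ih.append_left [x]
      · simpa [projC, List.filter_cons, hx, hxS] using ih

theorem nerodeEq_filter_of_projC (hcl : PartialCommClosed c L) {u v : List α}
    (h : ∀ i, NerodeEq L (projC c i u) (projC c i v)) (S : Finset (Fin k)) :
    NerodeEq L (u.filter (fun x => c x ∈ S)) (v.filter (fun x => c x ∈ S)) := by
  induction S using Finset.induction_on with
  | empty => simpa using (ContextEq.refl L []).nerodeEq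
  | insert i S hi ih =>
    have hcomm : ContextEq L (v.filter (fun x => c x ∈ S) ++ projC c i u)
        (projC c i u ++ v.filter (fun x => c x ∈ S)) := by
      apply hcl.contextEq_append_comm
      simp only [projC, List.mem_filter, decide_eq_true_eq]
      rintro x ⟨-, hx⟩ y ⟨-, rfl⟩ hxy
      exact hi (hxy ▸ hx)
    have hcomm' : ContextEq L (projC c i v ++ v.filter (fun x => c x ∈ S))
        (v.filter (fun x => c x ∈ S) ++ projC c i v) := by
      apply hcl.contextEq_append_comm
      simp only [projC, List.mem_filter, decide_eq_true_eq]
      rintro x ⟨-, rfl⟩ y ⟨-, hy⟩ hxy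
      exact hi (hxy ▸ hy)
    exact (hcl.contextEq_filter_insert hi u).nerodeEq.trans <|
      (ih.append_right _).trans <| hcomm.nerodeEq.trans <|
      ((h i).append_right _).trans <| hcomm'.nerodeEq.trans
        (hcl.contextEq_filter_insert hi v).symm.nerodeEq

theorem nerodeEq_of_projC (hcl : PartialCommClosed c L) {u v : List α}
    (h : ∀ i, NerodeEq L (projC c i u) (projC c i v)) : NerodeEq L u v := by
  simpa using hcl.nerodeEq_filter_of_projC h Finset.univ

end PartialCommClosed

theorem exists_projC_eq {α : Type*} {k : ℕ} (c : α → Fin k) (w : Fin k → List α)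
    (hw : ∀ i, ∀ x ∈ w i, c x = i) : ∃ u : List α, ∀ i, projC c i u = w i := by
  suffices h : ∀ S : Finset (Fin k), ∃ u : List α,
      ∀ i, projC c i u = if i ∈ S then w i else [] by
    simpa using h Finset.univ
  intro S
  induction S using Finset.induction_on with
  | empty => exact ⟨[], by simp [projC]⟩
  | insert j S hj ih =>
    obtain ⟨u, hu⟩ := ih
    refine ⟨u ++ w j, fun i => ?_⟩
    have happ : projC c i (u ++ w j) = projC c i u ++ projC c i (w j) := by
      simp [projC]
    rw [happ, hu]
    by_cases hij : i = j
    · subst hij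
      simpa [hj, projC] using hw i
    · have hnil : projC c i (w j) = [] := by
        simp only [projC, List.filter_eq_nil_iff, decide_eq_true_eq]
        intro x hx hxi
        exact hij (hxi.symm.trans (hw j x hx))
      simp [hnil, hij]

/-- For a regular language `L` closed under the partial commutation associated with the
partition `Σ = Σ_1 ∪ ⋯ ∪ Σ_k`: the number of Nerode classes of `L` equals the product
over `i` of the number of classes of words from `Σ_i*` iff for all `u, v`:
`u ≡_L v ⟺ π_{Σ_i}(u) ≡_L π_{Σ_i}(v)` for all `i`. In particular, the implication
from the right-hand condition to `u ≡_L v` holds for every such `L`. -/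
theorem stmt19 {α : Type*} {k : ℕ} (c : α → Fin k) (hsurj : Function.Surjective c)
    (L : Set (List α)) (hreg : RegularLang L) (hcl : PartialCommClosed c L) :
    ((Nat.card (Quotient (nerodeSetoid L)) =
        ∏ i : Fin k,
          Nat.card ((fun w : List α => (⟦w⟧ : Quotient (nerodeSetoid L))) ''
            {w : List α | ∀ x ∈ w, c x = i}))
      ↔ (∀ u v : List α,
          NerodeEq L u v ↔ ∀ i : Fin k, NerodeEq L (projC c i u) (projC c i v))) ∧
    (∀ u v : List α,
      (∀ i : Fin k, NerodeEq L (projC c i u) (projC c i v)) → NerodeEq L u v) := by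
  have himp : ∀ u v : List α,
      (∀ i : Fin k, NerodeEq L (projC c i u) (projC c i v)) → NerodeEq L u v :=
    fun u v h => hcl.nerodeEq_of_projC h
  refine ⟨?_, himp⟩
  have : Finite (Quotient (nerodeSetoid L)) := hreg
  have hQ : ∀ u v : List α,
      (⟦u⟧ : Quotient (nerodeSetoid L)) = ⟦v⟧ ↔ NerodeEq L u v := fun _ _ => Quotient.eq
  rw [← Nat.card_pi]
  let g : List α → ∀ i : Fin k, ((fun w : List α => (⟦w⟧ : Quotient (nerodeSetoid L))) ''
      {w : List α | ∀ x ∈ w, c x = i}) :=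
    fun u i => ⟨⟦projC c i u⟧, projC c i u, by simp [projC], rfl⟩
  have hg : ∀ u v, g u = g v ↔ ∀ i, NerodeEq L (projC c i u) (projC c i v) := by
    intro u v
    rw [funext_iff]
    exact forall_congr' fun i => Subtype.ext_iff.trans (hQ _ _)
  have hg_surj : Function.Surjective g := by
    intro p
    choose w hw hwp using fun i => (p i).2
    obtain ⟨u, hu⟩ := exists_projC_eq c w hw
    refine ⟨u, funext fun i => Subtype.ext ?_⟩
    simpa only [g, hu i] using hwp i
  let f : (∀ i : Fin k, ((fun w : List α => (⟦w⟧ : Quotient (nerodeSetoid L))) ''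
      {w : List α | ∀ x ∈ w, c x = i})) → Quotient (nerodeSetoid L) :=
    fun p => ⟦Function.surjInv hg_surj p⟧
  have hfg : ∀ u, f (g u) = ⟦u⟧ := fun u =>
    (hQ _ _).2 (himp _ _ ((hg _ _).1 (Function.surjInv_eq hg_surj (g u))))
  have hf_surj : Function.Surjective f := fun q =>
    Quotient.inductionOn q fun u => ⟨g u, hfg u⟩
  constructor
  · intro hcard u v
    refine ⟨fun h => (hg u v).1 ?_, himp u v⟩
    have hf_inj : Function.Injective f :=
      ((Nat.bijective_iff_surjective_and_card f).2 ⟨hf_surj, hcard.symm⟩).1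
    exact hf_inj (by rw [hfg, hfg, hQ]; exact h)
  · intro h
    refine (Nat.card_eq_of_bijective f ⟨?_, hf_surj⟩).symm
    intro p q hpq
    obtain ⟨u, rfl⟩ := hg_surj p
    obtain ⟨v, rfl⟩ := hg_surj q
    rw [hfg, hfg, hQ] at hpq
    exact (hg u v).2 ((h u v).1 hpq)
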